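/- The sequence of forms (Eⁿ)_{n≥0} is compatible: for any n,k ≥ 0 and any u ∈ ℝ^{V_n}, the minimum of E^{n+k}(v,v) over all v ∈ ℝ^{V_{n+k}} with v|_{V_n} = u is attained and equals Eⁿ(u,u). -/

import Mathlib

open scoped BigOperators ENNReal
open Set Filter MeasureTheory

noncomputable section

abbrev E2 : Type := EuclideanSpace ℝ (Fin 2)

/-- The index set `S_l` of the level-`l` thin Sierpinski gasket. -/
def Sset (l : ℕ) : Set (ℕ × ℕ) :=
  {p | p.1 + p.2 ≤ l - 1 ∧ p.1 * p.2 * (l - 1 - p.1 - p.2) = 0}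

/-- The contraction `f^l_i`. -/
def fmap (q : Fin 3 → E2) (l : ℕ) (i : ℕ × ℕ) (x : E2) : E2 :=
  q 0 + ((i.1 : ℝ) / l) • (q 1 - q 0) + ((i.2 : ℝ) / l) • (q 2 - q 0)
    + (l : ℝ)⁻¹ • (x - q 0)

/-- The closed equilateral triangle `△`. -/
def Tri (q : Fin 3 → E2) : Set E2 := convexHull ℝ (Set.range q)

def V0 (q : Fin 3 → E2) : Set E2 := Set.range q

/-- Words of length `n` (padded by `(0,0)` beyond position `n`). -/
def Wn (l : ℕ → ℕ) (n : ℕ) : Set (ℕ → ℕ × ℕ) :=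
  {w | (∀ k, k < n → w k ∈ Sset (l k)) ∧ ∀ k, n ≤ k → w k = (0, 0)}

/-- `wordMap q l w n = f^{l_1}_{w_1} ∘ ⋯ ∘ f^{l_n}_{w_n}` (0-indexed). -/
def wordMap (q : Fin 3 → E2) (l : ℕ → ℕ) (w : ℕ → ℕ × ℕ) : ℕ → E2 → E2
  | 0 => id
  | n + 1 => wordMap q l w n ∘ fmap q (l n) (w n)

/-- The thin scale irregular Sierpinski gasket `K`. -/
def Gasket (q : Fin 3 → E2) (l : ℕ → ℕ) : Set E2 :=
  ⋂ n, ⋃ w ∈ Wn l n, wordMap q l w n '' Tri q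

/-- The cell `K_w = K ∩ f_w(△)`. -/
def Cell (q : Fin 3 → E2) (l : ℕ → ℕ) (n : ℕ) (w : ℕ → ℕ × ℕ) : Set E2 :=
  Gasket q l ∩ wordMap q l w n '' Tri q

def Vn (q : Fin 3 → E2) (l : ℕ → ℕ) (n : ℕ) : Set E2 :=
  ⋃ w ∈ Wn l n, wordMap q l w n '' V0 q

def Vstar (q : Fin 3 → E2) (l : ℕ → ℕ) : Set E2 := ⋃ n, Vn q l n

def Ln (l : ℕ → ℕ) (n : ℕ) : ℕ := ∏ k ∈ Finset.range n, l k

def Mn (l : ℕ → ℕ) (n : ℕ) : ℕ := ∏ k ∈ Finset.range n, (3 * l k - 3)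

def rl (l : ℕ) : ℝ := (2 * (l : ℝ) / 3 + 1 / 9)⁻¹

def Rn (l : ℕ → ℕ) (n : ℕ) : ℝ := ∏ k ∈ Finset.range n, rl (l k)

def Tn (l : ℕ → ℕ) (n : ℕ) : ℝ := (Mn l n : ℝ) / Rn l n

/-- The basic energy form `E⁰` on `ℝ^{V₀}`. -/
def E0 (q : Fin 3 → E2) (u v : E2 → ℝ) : ℝ :=
  (1 / 2) * ∑ j : Fin 3, ∑ k : Fin 3, (u (q j) - u (q k)) * (v (q j) - v (q k))

/-- The level-`n` energy form `Eⁿ`. -/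
def En (q : Fin 3 → E2) (l : ℕ → ℕ) (n : ℕ) (u v : E2 → ℝ) : ℝ :=
  (Rn l n)⁻¹ * ∑ᶠ w ∈ Wn l n, E0 q (u ∘ wordMap q l w n) (v ∘ wordMap q l w n)

/-- The domain `F` of the limit resistance form. -/
def FDom (q : Fin 3 → E2) (l : ℕ → ℕ) : Set (E2 → ℝ) :=
  {u | ∃ C : ℝ, ∀ n, En q l n u u ≤ C}

/-- The limit form `E(u,v) = lim_n Eⁿ(u,v)`. -/
def EForm (q : Fin 3 → E2) (l : ℕ → ℕ) (u v : E2 → ℝ) : ℝ :=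
  limUnder atTop fun n => En q l n u v

/-- The intrinsic (geodesic) distance on `K`, with values in `ℝ≥0∞`. -/
def pdist (q : Fin 3 → E2) (l : ℕ → ℕ) (x y : E2) : ℝ≥0∞ :=
  ⨅ (γ : ℝ → E2) (_ : ContinuousOn γ (Set.Icc 0 1))
    (_ : Set.MapsTo γ (Set.Icc 0 1) (Gasket q l)) (_ : γ 0 = x) (_ : γ 1 = y),
    eVariationOn γ (Set.Icc 0 1)

def gdist (q : Fin 3 → E2) (l : ℕ → ℕ) (x y : E2) : ℝ := (pdist q l x y).toReal

/-- The set of resistance quotients used to define `R_E`. -/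
def REset (q : Fin 3 → E2) (l : ℕ → ℕ) (x y : E2) : Set ℝ :=
  {t | ∃ u ∈ FDom q l, 0 < EForm q l u u ∧ t = (u x - u y) ^ 2 / EForm q l u u}

/-- The resistance metric `R_E`. -/
def RE (q : Fin 3 → E2) (l : ℕ → ℕ) (x y : E2) : ℝ := sSup (REset q l x y)

/-- Resistance quotients over continuous representatives (i.e. `F` viewed in `C(K)`). -/
def REcSet (q : Fin 3 → E2) (l : ℕ → ℕ) (x y : E2) : Set ℝ :=
  {t | ∃ u ∈ FDom q l, ContinuousOn u (Gasket q l) ∧ 0 < EForm q l u u ∧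
    t = (u x - u y) ^ 2 / EForm q l u u}

def REc (q : Fin 3 → E2) (l : ℕ → ℕ) (x y : E2) : ℝ := sSup (REcSet q l x y)

/-- The open `d`-ball in `K`. -/
def Bd (q : Fin 3 → E2) (l : ℕ → ℕ) (x : E2) (s : ℝ) : Set E2 :=
  {y ∈ Gasket q l | gdist q l x y < s}

/-- The open `R_E`-ball in `K`. -/
def BRc (q : Fin 3 → E2) (l : ℕ → ℕ) (x : E2) (s : ℝ) : Set E2 :=
  {y ∈ Gasket q l | REc q l x y < s}

/-- `Λ^{(k)}_{n,w}`: words within `k` cell-steps of `w`. -/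
def Lam (q : Fin 3 → E2) (l : ℕ → ℕ) (n : ℕ) (w : ℕ → ℕ × ℕ) (k : ℕ) :
    Set (ℕ → ℕ × ℕ) :=
  {v ∈ Wn l n | ∃ c : ℕ → ℕ → ℕ × ℕ, c 0 = w ∧ c k = v ∧ (∀ j ≤ k, c j ∈ Wn l n) ∧
    ∀ j < k, (Cell q l n (c j) ∩ Cell q l n (c (j + 1))).Nonempty}

/-- `U^{(k)}_{n,w}`. -/
def Unwk (q : Fin 3 → E2) (l : ℕ → ℕ) (n : ℕ) (w : ℕ → ℕ × ℕ) (k : ℕ) : Set E2 :=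
  ⋃ v ∈ Lam q l n w k, Cell q l n v

def betaZero (l : ℕ → ℕ) : ℝ :=
  ⨅ n : ℕ, Real.logb (l n) (2 * (l n : ℝ) ^ 2 - (5 / 3) * (l n : ℝ) - 1 / 3)

def betaOne (l : ℕ → ℕ) : ℝ :=
  ⨆ n : ℕ, Real.logb (l n) (2 * (l n : ℝ) ^ 2 - (5 / 3) * (l n : ℝ) - 1 / 3)

def betaM (l : ℕ → ℕ) : ℝ := ⨅ n : ℕ, Real.logb (l n) (3 * (l n : ℝ) - 3)

def betaR (l : ℕ → ℕ) : ℝ := ⨆ n : ℕ, Real.logb (l n) ((rl (l n))⁻¹)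

/-- The value of `Ψ` on the interval `[1/L_{n+1}, 1/L_n]`. -/
def psiPiece (l : ℕ → ℕ) (n : ℕ) (s : ℝ) : ℝ :=
  (Tn l (n + 1))⁻¹
    * (1 + ((3 * (l n : ℝ) - 4) / ((l n : ℝ) - 1)) * ((Ln l (n + 1) : ℝ) * s - 1))
    * (1 + (((2 / 3) * (l n : ℝ) - 8 / 9) / ((l n : ℝ) - 1)) * ((Ln l (n + 1) : ℝ) * s - 1))

/-- `Ψ = Ψ_𝒍` is characterized by these defining clauses. -/
def IsPsi (l : ℕ → ℕ) (Psi : ℝ → ℝ) : Prop :=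
  (∀ n : ℕ, ∀ s : ℝ, ((Ln l (n + 1) : ℝ))⁻¹ ≤ s → s ≤ ((Ln l n : ℝ))⁻¹ →
      Psi s = psiPiece l n s) ∧
  (∀ s : ℝ, 1 ≤ s → Psi s = s ^ betaZero l) ∧ Psi 0 = 0

def psiMPiece (l : ℕ → ℕ) (n : ℕ) (s : ℝ) : ℝ :=
  ((Mn l (n + 1) : ℝ))⁻¹
    * (1 + ((3 * (l n : ℝ) - 4) / ((l n : ℝ) - 1)) * ((Ln l (n + 1) : ℝ) * s - 1))

def IsPsiM (l : ℕ → ℕ) (PsiM : ℝ → ℝ) : Prop :=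
  (∀ n : ℕ, ∀ s : ℝ, ((Ln l (n + 1) : ℝ))⁻¹ ≤ s → s ≤ ((Ln l n : ℝ))⁻¹ →
      PsiM s = psiMPiece l n s) ∧
  (∀ s : ℝ, 1 ≤ s → PsiM s = s ^ betaM l) ∧ PsiM 0 = 0

def psiRPiece (l : ℕ → ℕ) (n : ℕ) (s : ℝ) : ℝ :=
  Rn l (n + 1)
    * (1 + (((2 / 3) * (l n : ℝ) - 8 / 9) / ((l n : ℝ) - 1)) * ((Ln l (n + 1) : ℝ) * s - 1))

def IsPsiR (l : ℕ → ℕ) (PsiR : ℝ → ℝ) : Prop :=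
  (∀ n : ℕ, ∀ s : ℝ, ((Ln l (n + 1) : ℝ))⁻¹ ≤ s → s ≤ ((Ln l n : ℝ))⁻¹ →
      PsiR s = psiRPiece l n s) ∧
  (∀ s : ℝ, 1 ≤ s → PsiR s = s ^ betaR l) ∧ PsiR 0 = 0

/-- `μ` is the uniform distribution on `K`: a Borel measure carried by `K`
with `μ(K_w) = 1/M_{|w|}` for every word `w`. -/
def IsUnif (q : Fin 3 → E2) (l : ℕ → ℕ) (μ : Measure E2) : Prop :=
  μ (Gasket q l)ᶜ = 0 ∧ ∀ n : ℕ, ∀ w ∈ Wn l n, μ (Cell q l n w) = ((Mn l n : ℝ≥0∞))⁻¹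

/-- `μ` is the energy measure of `u`: a Borel measure carried by `K` with
`μ(K_w) = R_{|w|}⁻¹ E^{𝒍^{|w|}}(u∘F_w, u∘F_w)` for every word `w`. -/
def IsEnergyMeasure (q : Fin 3 → E2) (l : ℕ → ℕ) (u : E2 → ℝ) (μ : Measure E2) : Prop :=
  μ (Gasket q l)ᶜ = 0 ∧ ∀ n : ℕ, ∀ w ∈ Wn l n,
    μ (Cell q l n w) = ENNReal.ofReal ((Rn l n)⁻¹ *
      EForm q (fun k => l (k + n)) (u ∘ wordMap q l w n) (u ∘ wordMap q l w n))


set_option linter.unusedSimpArgs false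

/-- Bilinear energy of a triangle. -/
def eb (x y z x' y' z' : ℝ) : ℝ :=
  (x - y) * (x' - y') + (y - z) * (y' - z') + (x - z) * (x' - z')

lemma E0_eq (q : Fin 3 → E2) (u v : E2 → ℝ) :
    E0 q u v = eb (u (q 0)) (u (q 1)) (u (q 2)) (v (q 0)) (v (q 1)) (v (q 2)) := by
  simp only [E0, eb, Fin.sum_univ_three]; ring

/-- Energy of a lattice cell. -/
def ec (h g : ℕ → ℕ → ℝ) (p : ℕ × ℕ) : ℝ :=
  eb (h p.1 p.2) (h (p.1 + 1) p.2) (h p.1 (p.2 + 1))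
    (g p.1 p.2) (g (p.1 + 1) p.2) (g p.1 (p.2 + 1))

/-- The finset version of `Sset`. -/
def SF (l : ℕ) : Finset (ℕ × ℕ) :=
  (Finset.range l ×ˢ Finset.range l).filter
    fun p => p.1 + p.2 ≤ l - 1 ∧ p.1 * p.2 * (l - 1 - p.1 - p.2) = 0

lemma mem_SF {l : ℕ} (hl : 5 ≤ l) (p : ℕ × ℕ) : p ∈ SF l ↔ p ∈ Sset l := by
  simp only [SF, Sset, Finset.mem_filter, Finset.mem_product, Finset.mem_range, Set.mem_ofPred_eq]
  constructor
  · exact fun h => h.2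
  · exact fun h => ⟨by omega, h⟩

lemma sum_SF (m : ℕ) (F : ℕ × ℕ → ℝ) :
    ∑ p ∈ SF (m + 5), F p = ∑ k ∈ Finset.range (m + 4), F (k, 0)
      + ∑ k ∈ Finset.range (m + 4), F (m + 4 - k, k)
      + ∑ k ∈ Finset.range (m + 4), F (0, k + 1) := by
  have h : SF (m + 5) = ((Finset.range (m + 4)).image (fun k => (k, 0)) ∪
      (Finset.range (m + 4)).image (fun k => (m + 4 - k, k))) ∪
      (Finset.range (m + 4)).image (fun k => (0, k + 1)) := by
    ext ⟨a, b⟩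
    simp only [SF, Finset.mem_filter, Finset.mem_product, Finset.mem_range, Finset.mem_union,
      Finset.mem_image, Prod.mk.injEq, mul_eq_zero]
    constructor
    · rintro ⟨-, h1, (h2 | h2) | h2⟩
      · rcases Nat.eq_zero_or_pos b with hb | hb
        · left; left; exact ⟨0, by omega⟩
        · right; exact ⟨b - 1, by omega⟩
      · by_cases ha : a = m + 4
        · left; right; exact ⟨0, by omega⟩
        · left; left; exact ⟨a, by omega⟩
      · by_cases ha : a = 0
        · right; exact ⟨b - 1, by omega⟩
        · left; right; exact ⟨b, by omega⟩
    · rintro ((⟨k, h1, h2, h3⟩ | ⟨k, h1, h2, h3⟩) | ⟨k, h1, h2, h3⟩) <;> omega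
  rw [h, Finset.sum_union, Finset.sum_union, Finset.sum_image, Finset.sum_image, Finset.sum_image]
  · intro a _ b _ h; simp at h; omega
  · intro a _ b _ h; simp at h; omega
  · intro a _ b _ h; simp at h; omega
  · rw [Finset.disjoint_left]
    rintro ⟨a, b⟩ h1 h2
    simp only [Finset.mem_image, Finset.mem_range, Prod.mk.injEq] at h1 h2
    obtain ⟨k, _⟩ := h1; obtain ⟨k', _⟩ := h2; omega
  · rw [Finset.disjoint_left]
    rintro ⟨a, b⟩ h1 h2
    simp only [Finset.mem_union, Finset.mem_image, Finset.mem_range, Prod.mk.injEq] at h1 h2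
    obtain ⟨k', _⟩ := h2
    rcases h1 with ⟨k, _⟩ | ⟨k, _⟩ <;> omega

lemma sum_split (m : ℕ) (F : ℕ → ℝ) :
    ∑ k ∈ Finset.range (m + 4), F k =
      F 0 + F 1 + (∑ k ∈ Finset.range (m + 1), F (k + 2)) + F (m + 3) := by
  rw [Finset.sum_range_succ, Finset.sum_range_succ', Finset.sum_range_succ']
  ring

/-- Values of the harmonic extension on a side from a corner of value `x` to a corner of value
`y`, opposite corner `z`. -/
def Bd1 (l : ℕ) (x y z : ℝ) (s : ℕ) : ℝ :=
  if s = 0 then x else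
  if s = 1 then x - (9 / (6 * l + 1)) * (5 / 9 * (x - y) + 4 / 9 * (x - z)) else
  if s = l then y else
  if s + 1 = l then y - (9 / (6 * l + 1)) * (5 / 9 * (y - x) + 4 / 9 * (y - z)) else
  x - (9 / (6 * l + 1)) * (10 / 9 * (x - y) + 5 / 9 * (x - z) + 2 / 3 * ((s : ℝ) - 2) * (x - y))

/-- Values of the harmonic extension at the inner tips. -/
def Tp (l : ℕ) (x y z : ℝ) (s : ℕ) : ℝ :=
  if s = 1 then x - (9 / (6 * l + 1)) * (2 / 3 * (x - y) + 2 / 3 * (x - z)) else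
  if s + 2 = l then y - (9 / (6 * l + 1)) * (2 / 3 * (y - x) + 2 / 3 * (y - z)) else
  x - (9 / (6 * l + 1)) *
    (10 / 9 * (x - y) + 5 / 9 * (x - z) + 2 / 3 * ((s : ℝ) - 2 + 1 / 2) * (x - y))

/-- The harmonic extension. -/
def Hh (l : ℕ) (x y z : ℝ) (s t : ℕ) : ℝ :=
  if t = 0 then Bd1 l x y z s else
  if s = 0 then Bd1 l x z y t else
  if s + t = l then Bd1 l y z x t else
  if t = 1 then Tp l x y z s else
  if s = 1 then Tp l x z y t else
  Tp l y z x t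

lemma Hh_c0 (l : ℕ) (x y z : ℝ) : Hh l x y z 0 0 = x := by simp [Hh, Bd1]

lemma Hh_c1 (l : ℕ) (hl : 5 ≤ l) (x y z : ℝ) : Hh l x y z l 0 = y := by
  have h1 : l ≠ 0 := by omega
  have h2 : l ≠ 1 := by omega
  simp [Hh, Bd1, h1, h2]

lemma Hh_c2 (l : ℕ) (hl : 5 ≤ l) (x y z : ℝ) : Hh l x y z 0 l = z := by
  have h1 : l ≠ 0 := by omega
  have h2 : l ≠ 1 := by omega
  simp [Hh, Bd1, h1, h2]

lemma side1 (m : ℕ) (x y z : ℝ) (g : ℕ → ℕ → ℝ) :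
    ∑ k ∈ Finset.range (m + 1), ec (Hh (m + 5) x y z) g (k + 2, 0) =
      9 / (6 * ((m + 5 : ℕ) : ℝ) + 1) * (x - y) * (g 2 0 - g (m + 3) 0) := by
  have : ∀ k ∈ Finset.range (m + 1), ec (Hh (m + 5) x y z) g (k + 2, 0) =
      9 / (6 * ((m + 5 : ℕ) : ℝ) + 1) * (x - y) * (g (k + 2) 0 - g (k + 1 + 2) 0) := by
    intro k hk
    rw [Finset.mem_range] at hk
    have e1 : k + 2 ≠ m + 5 := by omega
    have e2 : k + 2 + 1 ≠ m + 5 := by omega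
    have e3 : k + 2 + 1 + 1 ≠ m + 5 := by omega
    have e4 : k + 2 + 2 ≠ m + 5 := by omega
    simp only [ec, eb, Hh, Bd1, Tp, e1, e2, e3, e4, if_true, if_false, Nat.add_eq_zero_iff,
      show k + 2 ≠ 0 by omega, show k + 2 ≠ 1 by omega, show k + 2 + 1 ≠ 0 by omega,
      show k + 2 + 1 ≠ 1 by omega, show (0 + 1 : ℕ) ≠ 0 by omega, show (0 + 1 : ℕ) = 1 by omega]
    push_cast
    ring
  rw [Finset.sum_congr rfl this, ← Finset.mul_sum,
    Finset.sum_range_sub' (fun k => g (k + 2) 0)]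

lemma side3 (m : ℕ) (x y z : ℝ) (g : ℕ → ℕ → ℝ) :
    ∑ k ∈ Finset.range (m + 1), ec (Hh (m + 5) x y z) g (0, k + 2) =
      9 / (6 * ((m + 5 : ℕ) : ℝ) + 1) * (x - z) * (g 0 2 - g 0 (m + 3)) := by
  have : ∀ k ∈ Finset.range (m + 1), ec (Hh (m + 5) x y z) g (0, k + 2) =
      9 / (6 * ((m + 5 : ℕ) : ℝ) + 1) * (x - z) * (g 0 (k + 2) - g 0 (k + 1 + 2)) := by
    intro k hk
    rw [Finset.mem_range] at hk
    have e1 : k + 2 ≠ m + 5 := by omega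
    have e2 : k + 2 + 1 ≠ m + 5 := by omega
    have e3 : k + 2 + 1 + 1 ≠ m + 5 := by omega
    have e4 : k + 2 + 2 ≠ m + 5 := by omega
    have e5 : 1 + (k + 2) ≠ m + 5 := by omega
    simp only [ec, eb, Hh, Bd1, Tp, e1, e2, e3, e4, e5, if_true, if_false, 
      show k + 2 ≠ 0 by omega, show k + 2 ≠ 1 by omega, show k + 2 + 1 ≠ 0 by omega,
      show k + 2 + 1 ≠ 1 by omega, show (0 + 1 : ℕ) = 1 by omega]
    simp only [one_ne_zero, if_false, if_true, and_false]
    push_cast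
    ring
  rw [Finset.sum_congr rfl this, ← Finset.mul_sum,
    Finset.sum_range_sub' (fun k => g 0 (k + 2))]

lemma side2 (m : ℕ) (x y z : ℝ) (g : ℕ → ℕ → ℝ) :
    ∑ k ∈ Finset.range (m + 1), ec (Hh (m + 5) x y z) g (m + 4 - (k + 2), k + 2) =
      9 / (6 * ((m + 5 : ℕ) : ℝ) + 1) * (y - z) * (g (m + 3) 2 - g 2 (m + 3)) := by
  have : ∀ k ∈ Finset.range (m + 1), ec (Hh (m + 5) x y z) g (m + 4 - (k + 2), k + 2) =
      9 / (6 * ((m + 5 : ℕ) : ℝ) + 1) * (y - z) *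
        (g (m + 3 - k) (k + 2) - g (m + 3 - (k + 1)) (k + 1 + 2)) := by
    intro k hk
    rw [Finset.mem_range] at hk
    obtain ⟨j, rfl⟩ : ∃ j, m = j + k := ⟨m - k, by omega⟩
    have a1 : j + k + 4 - (k + 2) = j + 2 := by omega
    have a2 : j + k + 3 - k = j + 3 := by omega
    have a3 : j + k + 3 - (k + 1) = j + 2 := by omega
    rw [a1, a2, a3]
    simp only [ec, eb, Hh, Bd1, Tp, 
      show k + 2 ≠ 0 by omega, show k + 2 ≠ 1 by omega, show k + 2 + 1 ≠ 0 by omega,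
      show k + 2 + 1 ≠ 1 by omega, show j + 2 ≠ 0 by omega, show j + 2 ≠ 1 by omega,
      show j + 2 + 1 ≠ 0 by omega, show j + 2 + 1 ≠ 1 by omega,
      show j + 2 + (k + 2) ≠ j + k + 5 by omega,
      show j + 2 + 1 + (k + 2) = j + k + 5 by omega,
      show j + 2 + (k + 2 + 1) = j + k + 5 by omega,
      show k + 2 + 2 ≠ j + k + 5 by omega, show k + 2 ≠ j + k + 5 by omega,
      show k + 2 + 1 ≠ j + k + 5 by omega, show k + 2 + 1 + 1 ≠ j + k + 5 by omega,
      if_true, if_false]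
    push_cast
    ring
  rw [Finset.sum_congr rfl this, ← Finset.mul_sum,
    Finset.sum_range_sub' (fun k => g (m + 3 - k) (k + 2))]
  have : m + 3 - (m + 1) = 2 := by omega
  simp only [this, Nat.sub_zero]

lemma key_identity (l : ℕ) (hl : 5 ≤ l) (x y z : ℝ) (g : ℕ → ℕ → ℝ) :
    ∑ p ∈ SF l, ec (Hh l x y z) g p = rl l * eb x y z (g 0 0) (g l 0) (g 0 l) := by
  obtain ⟨m, rfl⟩ : ∃ m, l = m + 5 := ⟨l - 5, by omega⟩
  rw [sum_SF, sum_split, sum_split]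
  have h3 : ∑ k ∈ Finset.range (m + 4), ec (Hh (m + 5) x y z) g (0, k + 1) =
     ec (Hh (m + 5) x y z) g (0, 1) + (∑ k ∈ Finset.range (m + 1), ec (Hh (m + 5) x y z) g (0, k + 2))
      + ec (Hh (m + 5) x y z) g (0, m + 3) + ec (Hh (m + 5) x y z) g (0, m + 4) := by
    rw [Finset.sum_range_succ, Finset.sum_range_succ, Finset.sum_range_succ']
    ring
  rw [h3, side1, side2, side3]
  have hr : rl (m + 5) = 9 / (6 * ((m + 5 : ℕ) : ℝ) + 1) := by
    rw [rl]
    field_simp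
    ring
  rw [hr]
  have b1 : m + 4 - 0 = m + 4 := by omega
  have b2 : m + 4 - 1 = m + 3 := by omega
  have b3 : m + 4 - (m + 3) = 1 := by omega
  rw [b1, b2, b3]
  have hd : (9 / (6 * ((m + 5 : ℕ) : ℝ) + 1)) * (6 * (m + 5) + 1) = 9 := by
    push_cast
    field_simp
  simp only [ec, eb, Hh, Bd1, Tp]
  generalize 9 / (6 * ((m + 5 : ℕ) : ℝ) + 1) = d at *
  simp [show m + 3 + 1 + 1 = m + 5 by omega, show m + 3 + 1 = m + 4 by omega,
    show m + 4 + 1 = m + 5 by omega, show m + 3 + 2 = m + 5 by omega,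
    show 1 + (m + 3) = m + 4 by omega, show 1 + (m + 4) = m + 5 by omega,
    show 2 + (m + 3) = m + 5 by omega, show 1 + 1 + (m + 3) = m + 5 by omega,
    show (1 : ℕ) + 1 = 2 by omega]
  linear_combination (-(x - y) / 9 * (2 * g (m + 3) 0 - g (m + 4) 0 - g (m + 3) 1)
    - (y - z) / 9 * (2 * g 2 (m + 3) - g 1 (m + 3) - g 1 (m + 4))
    - (x - z) / 9 * (2 * g 0 (m + 3) - g 1 (m + 3) - g 0 (m + 4))) * hd


lemma key_eq (l : ℕ) (hl : 5 ≤ l) (x y z : ℝ) :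
    ∑ p ∈ SF l, ec (Hh l x y z) (Hh l x y z) p = rl l * eb x y z x y z := by
  rw [key_identity l hl, Hh_c0, Hh_c1 l hl, Hh_c2 l hl]

lemma key_le (l : ℕ) (hl : 5 ≤ l) (g : ℕ → ℕ → ℝ) :
    rl l * eb (g 0 0) (g l 0) (g 0 l) (g 0 0) (g l 0) (g 0 l) ≤ ∑ p ∈ SF l, ec g g p := by
  set h := Hh l (g 0 0) (g l 0) (g 0 l) with hh
  have h1 := key_eq l hl (g 0 0) (g l 0) (g 0 l)
  have h2 := key_identity l hl (g 0 0) (g l 0) (g 0 l) g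
  rw [← hh] at h1 h2
  have h3 : ∀ p ∈ SF l, 2 * ec h g p - ec h h p ≤ ec g g p := by
    intro p _
    simp only [ec, eb]
    nlinarith [sq_nonneg ((h p.1 p.2 - h (p.1 + 1) p.2) - (g p.1 p.2 - g (p.1 + 1) p.2)),
      sq_nonneg ((h (p.1 + 1) p.2 - h p.1 (p.2 + 1)) - (g (p.1 + 1) p.2 - g p.1 (p.2 + 1))),
      sq_nonneg ((h p.1 p.2 - h p.1 (p.2 + 1)) - (g p.1 p.2 - g p.1 (p.2 + 1)))]
  have h4 := Finset.sum_le_sum h3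
  rw [Finset.sum_sub_distrib, ← Finset.mul_sum] at h4
  linarith

/-- Lattice points. -/
def pt (q : Fin 3 → E2) (L a b : ℕ) : E2 :=
  q 0 + ((a : ℝ) / L) • (q 1 - q 0) + ((b : ℝ) / L) • (q 2 - q 0)

lemma q_indep (q : Fin 3 → E2) (hq : ∀ j k : Fin 3, j ≠ k → dist (q j) (q k) = 1)
    (x y : ℝ) (h : x • (q 1 - q 0) + y • (q 2 - q 0) = 0) : x = 0 ∧ y = 0 := by
  have h1 : ‖q 1 - q 0‖ = 1 := by rw [← dist_eq_norm]; exact hq 1 0 (by decide)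
  have h2 : ‖q 2 - q 0‖ = 1 := by rw [← dist_eq_norm]; exact hq 2 0 (by decide)
  have h3 : ‖(q 1 - q 0) - (q 2 - q 0)‖ = 1 := by
    rw [sub_sub_sub_cancel_right, ← dist_eq_norm]; exact hq 1 2 (by decide)
  have h4 := norm_sub_sq_real (q 1 - q 0) (q 2 - q 0)
  rw [h1, h2, h3] at h4
  have h5 := norm_add_sq_real (x • (q 1 - q 0)) (y • (q 2 - q 0))
  rw [h, norm_smul, norm_smul, h1, h2, real_inner_smul_left, real_inner_smul_right] at h5
  simp only [norm_zero, Real.norm_eq_abs, mul_one, sq_abs] at h5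
  have h6 : x ^ 2 + x * y + y ^ 2 = 0 := by
    have : inner ℝ (q 1 - q 0) (q 2 - q 0) = (1 / 2 : ℝ) := by linarith
    rw [this] at h5; linarith
  constructor <;> nlinarith [sq_nonneg (x + y), sq_nonneg (x - y), sq_nonneg x, sq_nonneg y]

lemma pt_inj (q : Fin 3 → E2) (hq : ∀ j k : Fin 3, j ≠ k → dist (q j) (q k) = 1)
    {L a b a' b' : ℕ} (hL : 0 < L) (h : pt q L a b = pt q L a' b') : a = a' ∧ b = b' := by
  have hL' : (L : ℝ) ≠ 0 := by positivity
  have := q_indep q hq ((a : ℝ) / L - (a' : ℝ) / L) ((b : ℝ) / L - (b' : ℝ) / L) (by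
    rw [sub_smul, sub_smul]
    have h' := sub_eq_zero.mpr h
    rw [← h']
    simp only [pt]
    abel)
  obtain ⟨h1, h2⟩ := this
  rw [← sub_div, div_eq_zero_iff] at h1 h2
  constructor
  · have := h1.resolve_right hL'
    exact_mod_cast sub_eq_zero.mp this
  · have := h2.resolve_right hL'
    exact_mod_cast sub_eq_zero.mp this

lemma pt_scale (q : Fin 3 → E2) (L l a b : ℕ) (hl : 0 < l) :
    pt q (L * l) (a * l) (b * l) = pt q L a b := by
  have : (l : ℝ) ≠ 0 := by positivity
  simp only [pt, Nat.cast_mul, mul_div_mul_right _ _ this]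

lemma Ln_pos (l : ℕ → ℕ) (hl : ∀ n, 5 ≤ l n) (n : ℕ) : 0 < Ln l n :=
  Finset.prod_pos fun i _ => by have := hl i; omega

lemma Ln_succ (l : ℕ → ℕ) (n : ℕ) : Ln l (n + 1) = Ln l n * l n := Finset.prod_range_succ _ _

lemma wordMap_form (q : Fin 3 → E2) (l : ℕ → ℕ) (hl : ∀ n, 5 ≤ l n) (w : ℕ → ℕ × ℕ) (n : ℕ) :
    ∃ a b : ℕ, ∀ x, wordMap q l w n x = pt q (Ln l n) a b + ((Ln l n : ℝ))⁻¹ • (x - q 0) := by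
  induction n with
  | zero => exact ⟨0, 0, fun x => by simp [wordMap, pt, Ln]⟩
  | succ n ih =>
    obtain ⟨a, b, h⟩ := ih
    refine ⟨a * l n + (w n).1, b * l n + (w n).2, fun x => ?_⟩
    have h1 : ((l n : ℕ) : ℝ) ≠ 0 := by have := hl n; positivity
    have h2 : ((Ln l n : ℕ) : ℝ) ≠ 0 := by have := Ln_pos l hl n; positivity
    simp only [wordMap, Function.comp_apply, h, fmap, pt, Ln_succ]
    push_cast
    simp only [add_div, add_smul, smul_sub, smul_add, smul_smul, div_eq_mul_inv, mul_inv]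
    match_scalars <;> field_simp <;> ring

lemma fmap_pt (q : Fin 3 → E2) (L l a b : ℕ) (hL : 0 < L) (hl : 0 < l) (i : ℕ × ℕ) (c d : ℕ) :
    pt q L a b + ((L : ℝ))⁻¹ • (fmap q l i (pt q 1 c d) - q 0) =
      pt q (L * l) (a * l + i.1 + c) (b * l + i.2 + d) := by
  have h1 : (l : ℝ) ≠ 0 := by positivity
  have h2 : (L : ℝ) ≠ 0 := by positivity
  simp only [fmap, pt]
  push_cast
  simp only [add_div, add_smul, smul_sub, smul_add, smul_smul, div_eq_mul_inv, mul_inv]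
  match_scalars <;> field_simp <;> ring

lemma q0_pt (q : Fin 3 → E2) : q 0 = pt q 1 0 0 := by simp [pt]
lemma q1_pt (q : Fin 3 → E2) : q 1 = pt q 1 1 0 := by simp [pt]
lemma q2_pt (q : Fin 3 → E2) : q 2 = pt q 1 0 1 := by simp [pt]

lemma base_pt (q : Fin 3 → E2) (L a b : ℕ) (c d : ℕ) :
    pt q L a b + ((L : ℝ))⁻¹ • (pt q 1 c d - q 0) = pt q L (a + c) (b + d) := by
  simp only [pt]
  push_cast
  simp only [add_div, add_smul, smul_sub, smul_add, div_one, smul_smul, div_eq_inv_mul]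
  module

/-- The finset of words. -/
def WF (l : ℕ → ℕ) : ℕ → Finset (ℕ → ℕ × ℕ)
  | 0 => {fun _ => (0, 0)}
  | n + 1 => by
      classical
      exact (WF l n ×ˢ SF (l n)).image fun p => Function.update p.1 n p.2

lemma mem_WF (l : ℕ → ℕ) (hl : ∀ n, 5 ≤ l n) (n : ℕ) (w : ℕ → ℕ × ℕ) :
    w ∈ WF l n ↔ w ∈ Wn l n := by
  induction n generalizing w with
  | zero =>
    simp only [WF, Finset.mem_singleton, Wn]
    constructor
    · rintro rfl; exact ⟨fun k hk => absurd hk (by omega), fun k _ => rfl⟩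
    · rintro ⟨-, h⟩; exact funext fun k => h k (by omega)
  | succ n ih =>
    simp only [WF, Finset.mem_image, Finset.mem_product, Prod.exists, ih, mem_SF (hl n)]
    constructor
    · rintro ⟨w', i1, i2, ⟨⟨h1, h2⟩, h3⟩, rfl⟩
      refine ⟨fun k hk => ?_, fun k hk => ?_⟩
      · by_cases hkn : k = n
        · subst hkn; simpa using h3
        · rw [Function.update_of_ne hkn]; exact h1 k (by omega)
      · rw [Function.update_of_ne (by omega)]; exact h2 k (by omega)
    · rintro ⟨h1, h2⟩
      refine ⟨Function.update w n (0, 0), (w n).1, (w n).2, ⟨⟨fun k hk => ?_, fun k hk => ?_⟩, h1 n (by omega)⟩, ?_⟩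
      · rw [Function.update_of_ne (by omega)]; exact h1 k (by omega)
      · by_cases hkn : k = n
        · subst hkn; simp
        · rw [Function.update_of_ne hkn]; exact h2 k (by omega)
      · simp

lemma sum_WF_succ (l : ℕ → ℕ) (hl : ∀ n, 5 ≤ l n) (n : ℕ) (F : (ℕ → ℕ × ℕ) → ℝ) :
    ∑ w ∈ WF l (n + 1), F w = ∑ w ∈ WF l n, ∑ i ∈ SF (l n), F (Function.update w n i) := by
  classical
  have e : WF l (n + 1) = (WF l n ×ˢ SF (l n)).image fun p => Function.update p.1 n p.2 := by
    ext w; simp [WF]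
  rw [e, Finset.sum_image, Finset.sum_product]
  rintro ⟨w, i⟩ h ⟨w', i'⟩ h' heq
  simp only [Finset.coe_product, Set.mem_prod, Finset.mem_coe, mem_WF l hl] at h h'
  simp only at heq
  have hi : i = i' := by simpa using congrFun heq n
  have hw : w = w' := by
    funext k
    by_cases hk : k = n
    · subst hk; rw [h.1.2 k le_rfl, h'.1.2 k le_rfl]
    · simpa [Function.update_of_ne hk] using congrFun heq k
  rw [hi, hw]

lemma wordMap_congr (q : Fin 3 → E2) (l : ℕ → ℕ) (w w' : ℕ → ℕ × ℕ) (n : ℕ)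
    (h : ∀ k < n, w k = w' k) : wordMap q l w n = wordMap q l w' n := by
  induction n with
  | zero => rfl
  | succ n ih =>
    simp only [wordMap]
    rw [ih fun k hk => h k (by omega), h n (by omega)]

lemma wordMap_update (q : Fin 3 → E2) (l : ℕ → ℕ) (w : ℕ → ℕ × ℕ) (n : ℕ) (i : ℕ × ℕ) :
    wordMap q l (Function.update w n i) (n + 1) = wordMap q l w n ∘ fmap q (l n) i := by
  simp only [wordMap, Function.update_self]
  rw [wordMap_congr q l _ w n fun k hk => Function.update_of_ne (by omega) _ _]

lemma En_eq (q : Fin 3 → E2) (l : ℕ → ℕ) (hl : ∀ n, 5 ≤ l n) (n : ℕ) (u : E2 → ℝ) :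
    En q l n u u = (Rn l n)⁻¹ * ∑ w ∈ WF l n, E0 q (u ∘ wordMap q l w n) (u ∘ wordMap q l w n) := by
  have : Wn l n = (WF l n : Set (ℕ → ℕ × ℕ)) := by
    ext w; rw [Finset.mem_coe, mem_WF l hl]
  rw [En, this, finsum_mem_coe_finset]

lemma rl_pos (l : ℕ) : 0 < rl l := by rw [rl]; positivity

lemma Rn_pos (l : ℕ → ℕ) (n : ℕ) : 0 < Rn l n := Finset.prod_pos fun i _ => rl_pos _

/-- The lattice function of `v` in the cell at `(a, b)`. -/
def gv (q : Fin 3 → E2) (L l a b : ℕ) (v : E2 → ℝ) (s t : ℕ) : ℝ :=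
  v (pt q (L * l) (a * l + s) (b * l + t))

lemma E0_cell (q : Fin 3 → E2) (l : ℕ → ℕ) (w : ℕ → ℕ × ℕ) (n : ℕ) (a b : ℕ)
    (h : ∀ x, wordMap q l w n x = pt q (Ln l n) a b + ((Ln l n : ℝ))⁻¹ • (x - q 0))
    (u : E2 → ℝ) :
    E0 q (u ∘ wordMap q l w n) (u ∘ wordMap q l w n) =
      eb (u (pt q (Ln l n) a b)) (u (pt q (Ln l n) (a + 1) b)) (u (pt q (Ln l n) a (b + 1)))
      (u (pt q (Ln l n) a b)) (u (pt q (Ln l n) (a + 1) b)) (u (pt q (Ln l n) a (b + 1))) := by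
  have e0 := base_pt q (Ln l n) a b 0 0
  have e1 := base_pt q (Ln l n) a b 1 0
  have e2 := base_pt q (Ln l n) a b 0 1
  rw [← q0_pt] at e0
  rw [← q1_pt] at e1
  rw [← q2_pt] at e2
  simp only [add_zero] at e0 e1 e2
  rw [E0_eq]
  simp only [Function.comp_apply, h]
  rw [e0, e1, e2]

lemma E0_subcell (q : Fin 3 → E2) (l : ℕ → ℕ) (hl : ∀ n, 5 ≤ l n) (w : ℕ → ℕ × ℕ) (n : ℕ)
    (a b : ℕ)
    (h : ∀ x, wordMap q l w n x = pt q (Ln l n) a b + ((Ln l n : ℝ))⁻¹ • (x - q 0))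
    (u : E2 → ℝ) (i : ℕ × ℕ) :
    E0 q (u ∘ wordMap q l (Function.update w n i) (n + 1))
      (u ∘ wordMap q l (Function.update w n i) (n + 1)) =
      ec (gv q (Ln l n) (l n) a b u) (gv q (Ln l n) (l n) a b u) i := by
  have hl' : 0 < l n := by have := hl n; omega
  have e0 := fmap_pt q (Ln l n) (l n) a b (Ln_pos l hl n) hl' i 0 0
  have e1 := fmap_pt q (Ln l n) (l n) a b (Ln_pos l hl n) hl' i 1 0
  have e2 := fmap_pt q (Ln l n) (l n) a b (Ln_pos l hl n) hl' i 0 1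
  rw [← q0_pt] at e0
  rw [← q1_pt] at e1
  rw [← q2_pt] at e2
  simp only [add_zero] at e0 e1 e2
  rw [E0_eq, wordMap_update]
  simp only [Function.comp_apply, h]
  rw [e0, e1, e2]
  simp only [ec, gv, add_assoc]

lemma gv_corner (q : Fin 3 → E2) (L l a b : ℕ) (hl : 0 < l) (v : E2 → ℝ) :
    gv q L l a b v 0 0 = v (pt q L a b) ∧ gv q L l a b v l 0 = v (pt q L (a + 1) b) ∧
      gv q L l a b v 0 l = v (pt q L a (b + 1)) := by
  simp only [gv]
  refine ⟨?_, ?_, ?_⟩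
  · rw [← pt_scale q L l a b hl]; simp
  · rw [← pt_scale q L l (a + 1) b hl]; congr 2; ring
  · rw [← pt_scale q L l a (b + 1) hl]; congr 2; ring

lemma En_succ (q : Fin 3 → E2) (l : ℕ → ℕ) (hl : ∀ n, 5 ≤ l n) (n : ℕ) (u : E2 → ℝ) :
    En q l (n + 1) u u = (Rn l n)⁻¹ * ∑ w ∈ WF l n, ((rl (l n))⁻¹ * ∑ i ∈ SF (l n),
      E0 q (u ∘ wordMap q l (Function.update w n i) (n + 1))
      (u ∘ wordMap q l (Function.update w n i) (n + 1))) := by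
  rw [En_eq q l hl, sum_WF_succ l hl, Rn, Finset.prod_range_succ, ← Rn, mul_inv, mul_assoc,
    ← Finset.mul_sum]

lemma En_mono (q : Fin 3 → E2) (l : ℕ → ℕ) (hl : ∀ n, 5 ≤ l n) (n : ℕ) (v : E2 → ℝ) :
    En q l n v v ≤ En q l (n + 1) v v := by
  rw [En_succ q l hl, En_eq q l hl]
  refine mul_le_mul_of_nonneg_left (Finset.sum_le_sum fun w _ => ?_) (inv_nonneg.mpr (Rn_pos l n).le)
  obtain ⟨a, b, h⟩ := wordMap_form q l hl w n
  rw [E0_cell q l w n a b h, Finset.sum_congr rfl fun i _ => E0_subcell q l hl w n a b h v i]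
  obtain ⟨c0, c1, c2⟩ := gv_corner q (Ln l n) (l n) a b (by have := hl n; omega) v
  have := key_le (l n) (hl n) (gv q (Ln l n) (l n) a b v)
  rw [c0, c1, c2] at this
  rw [inv_mul_eq_div, le_div_iff₀ (rl_pos _)]
  linarith

/-- Harmonic value at the lattice point `(s, t)` of the cell `(a, b)`. -/
def hv (q : Fin 3 → E2) (L l : ℕ) (u : E2 → ℝ) (a b s t : ℕ) : ℝ :=
  Hh l (u (pt q L a b)) (u (pt q L (a + 1) b)) (u (pt q L a (b + 1))) s t

lemma hv_wd (q : Fin 3 → E2) (L l : ℕ) (hl : 5 ≤ l) (u : E2 → ℝ) (a b s t a' b' s' t' : ℕ)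
    (h : s + t ≤ l) (h' : s' + t' ≤ l) (h1 : a * l + s = a' * l + s')
    (h2 : b * l + t = b' * l + t') : hv q L l u a b s t = hv q L l u a' b' s' t' := by
  have c0 : ∀ a b, hv q L l u a b 0 0 = u (pt q L a b) := fun a b => Hh_c0 _ _ _ _
  have c1 : ∀ a b, hv q L l u a b l 0 = u (pt q L (a + 1) b) := fun a b => Hh_c1 _ hl _ _ _
  have c2 : ∀ a b, hv q L l u a b 0 l = u (pt q L a (b + 1)) := fun a b => Hh_c2 _ hl _ _ _
  have aux : ∀ a a' s s' : ℕ, s ≤ l → s' ≤ l → a * l + s = a' * l + s' →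
      (a = a' ∧ s = s') ∨ (a' = a + 1 ∧ s = l ∧ s' = 0) ∨ (a = a' + 1 ∧ s' = l ∧ s = 0) := by
    intro a a' s s' hs hs' he
    rcases lt_trichotomy a a' with hlt | rfl | hlt
    · right; left
      obtain ⟨k, rfl⟩ : ∃ k, a' = a + 1 + k := ⟨a' - a - 1, by omega⟩
      have : k = 0 := by
        by_contra hk
        have : 1 ≤ k := by omega
        nlinarith
      subst this
      have : a * l + s = a * l + l + s' := by rw [he]; ring
      omega
    · left; omega
    · right; right
      obtain ⟨k, rfl⟩ : ∃ k, a = a' + 1 + k := ⟨a - a' - 1, by omega⟩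
      have : k = 0 := by
        by_contra hk
        have : 1 ≤ k := by omega
        nlinarith
      subst this
      have : a' * l + s' = a' * l + l + s := by rw [← he]; ring
      omega
  rcases aux a a' s s' (by omega) (by omega) h1 with ⟨rfl, rfl⟩ | ⟨rfl, rfl, rfl⟩ | ⟨rfl, rfl, rfl⟩ <;>
  rcases aux b b' t t' (by omega) (by omega) h2 with ⟨rfl, rfl⟩ | ⟨rfl, rfl, rfl⟩ | ⟨rfl, rfl, rfl⟩
  · rfl
  · obtain rfl : s = 0 := by omega
    rw [c0, c2]
  · obtain rfl : s = 0 := by omega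
    rw [c0, c2]
  · obtain rfl : t = 0 := by omega
    rw [c0, c1]
  · omega
  · rw [c1, c2]
  · obtain rfl : t = 0 := by omega
    rw [c0, c1]
  · rw [c1, c2]
  · omega

lemma ext_step (q : Fin 3 → E2) (hq : ∀ j k : Fin 3, j ≠ k → dist (q j) (q k) = 1)
    (l : ℕ → ℕ) (hl : ∀ n, 5 ≤ l n) (n : ℕ) (u : E2 → ℝ) :
    ∃ v : E2 → ℝ, Set.EqOn v u (Vn q l n) ∧ En q l (n + 1) v v = En q l n u u := by
  classical
  have hl' : 0 < l n := by have := hl n; omega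
  let P : E2 → ℕ × ℕ × ℕ × ℕ → Prop := fun x c =>
    c.2.2.1 + c.2.2.2 ≤ l n ∧ x = pt q (Ln l n * l n) (c.1 * l n + c.2.2.1) (c.2.1 * l n + c.2.2.2)
  let v : E2 → ℝ := fun x => if h : ∃ c, P x c then
    hv q (Ln l n) (l n) u h.choose.1 h.choose.2.1 h.choose.2.2.1 h.choose.2.2.2 else 0
  have hvv : ∀ a b s t, s + t ≤ l n →
      gv q (Ln l n) (l n) a b v s t = hv q (Ln l n) (l n) u a b s t := by
    intro a b s t hst
    have hex : ∃ c, P (pt q (Ln l n * l n) (a * l n + s) (b * l n + t)) c :=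
      ⟨(a, b, s, t), hst, rfl⟩
    simp only [gv, v]
    rw [dif_pos hex]
    obtain ⟨h1, h2⟩ := hex.choose_spec
    obtain ⟨h3, h4⟩ := pt_inj q hq (Nat.mul_pos (Ln_pos l hl n) hl') h2
    exact hv_wd q (Ln l n) (l n) (hl n) u _ _ _ _ _ _ _ _ h1 hst h3.symm h4.symm
  have hvu : ∀ a b, v (pt q (Ln l n) a b) = u (pt q (Ln l n) a b) := by
    intro a b
    have := hvv a b 0 0 (by omega)
    rw [(gv_corner q (Ln l n) (l n) a b hl' v).1] at this
    rw [this]; exact Hh_c0 _ _ _ _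
  refine ⟨v, ?_, ?_⟩
  · intro x hx
    simp only [Vn, Set.mem_iUnion] at hx
    obtain ⟨w, hw, y, hy, rfl⟩ := hx
    obtain ⟨a, b, h⟩ := wordMap_form q l hl w n
    have : ∃ c d, y = pt q 1 c d := by
      obtain ⟨j, rfl⟩ := hy
      fin_cases j
      · exact ⟨_, _, q0_pt q⟩
      · exact ⟨_, _, q1_pt q⟩
      · exact ⟨_, _, q2_pt q⟩
    obtain ⟨c, d, rfl⟩ := this
    rw [h, base_pt]
    exact hvu _ _
  · rw [En_succ q l hl, En_eq q l hl]
    congr 1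
    refine Finset.sum_congr rfl fun w _ => ?_
    obtain ⟨a, b, h⟩ := wordMap_form q l hl w n
    rw [E0_cell q l w n a b h, Finset.sum_congr rfl fun i _ => E0_subcell q l hl w n a b h v i]
    have e : ∑ i ∈ SF (l n), ec (gv q (Ln l n) (l n) a b v) (gv q (Ln l n) (l n) a b v) i =
        ∑ i ∈ SF (l n), ec (hv q (Ln l n) (l n) u a b) (hv q (Ln l n) (l n) u a b) i := by
      refine Finset.sum_congr rfl fun i hi => ?_
      have hi' := ((mem_SF (hl n) i).mp hi).1
      simp only [ec]
      rw [hvv _ _ _ _ (by omega), hvv _ _ _ _ (by omega), hvv _ _ _ _ (by omega)]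
    rw [e]
    have := key_eq (l n) (hl n) (u (pt q (Ln l n) a b)) (u (pt q (Ln l n) (a + 1) b))
      (u (pt q (Ln l n) a (b + 1)))
    have this' : ∑ i ∈ SF (l n), ec (hv q (Ln l n) (l n) u a b) (hv q (Ln l n) (l n) u a b) i =
        _ := this
    rw [this', inv_mul_cancel_left₀ (rl_pos _).ne']

lemma Vn_sub (q : Fin 3 → E2) (l : ℕ → ℕ) (hl : ∀ n, 5 ≤ l n) (n : ℕ) :
    Vn q l n ⊆ Vn q l (n + 1) := by
  intro x hx
  simp only [Vn, Set.mem_iUnion] at hx ⊢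
  obtain ⟨w, hw, y, ⟨j, rfl⟩, rfl⟩ := hx
  have h1 : ((l n : ℕ) : ℝ) ≠ 0 := by have := hl n; positivity
  have : ∃ i ∈ Sset (l n), fmap q (l n) i (q j) = q j := by
    have hc : ((l n - 1 : ℕ) : ℝ) = (l n : ℝ) - 1 := by
      rw [Nat.cast_sub (by have := hl n; omega)]; simp
    fin_cases j
    · exact ⟨(0, 0), by simp [Sset], by simp [fmap]⟩
    · refine ⟨(l n - 1, 0), by simp [Sset], ?_⟩
      simp only [fmap, hc]
      rw [sub_div, div_self h1]
      simp
      module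
    · refine ⟨(0, l n - 1), by simp [Sset], ?_⟩
      simp only [fmap, hc]
      rw [sub_div, div_self h1]
      simp
      module
  obtain ⟨i, hi, hf⟩ := this
  refine ⟨Function.update w n i, ?_, q j, ⟨j, rfl⟩, ?_⟩
  · rw [← mem_WF l hl] at hw ⊢
    simp only [WF, Finset.mem_image, Finset.mem_product, Prod.exists]
    exact ⟨w, i.1, i.2, ⟨hw, (mem_SF (hl n) i).mpr hi⟩, rfl⟩
  · rw [wordMap_update, Function.comp_apply, hf]

lemma Vn_sub_add (q : Fin 3 → E2) (l : ℕ → ℕ) (hl : ∀ n, 5 ≤ l n) (n k : ℕ) :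
    Vn q l n ⊆ Vn q l (n + k) := by
  induction k with
  | zero => exact subset_rfl
  | succ k ih => exact ih.trans (Vn_sub q l hl (n + k))

lemma En_mono_add (q : Fin 3 → E2) (l : ℕ → ℕ) (hl : ∀ n, 5 ≤ l n) (n k : ℕ) (v : E2 → ℝ) :
    En q l n v v ≤ En q l (n + k) v v := by
  induction k with
  | zero => exact le_rfl
  | succ k ih => exact ih.trans (En_mono q l hl (n + k) v)

lemma En_congr (q : Fin 3 → E2) (l : ℕ → ℕ) (n : ℕ) (u v : E2 → ℝ)
    (h : Set.EqOn v u (Vn q l n)) : En q l n v v = En q l n u u := by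
  simp only [En]
  congr 1
  refine finsum_mem_congr rfl fun w hw => ?_
  have : ∀ j, v (wordMap q l w n (q j)) = u (wordMap q l w n (q j)) := fun j => by
    apply h
    simp only [Vn, Set.mem_iUnion]
    exact ⟨w, hw, q j, ⟨j, rfl⟩, rfl⟩
  simp only [E0, Function.comp_apply, this]

lemma ext_add (q : Fin 3 → E2) (hq : ∀ j k : Fin 3, j ≠ k → dist (q j) (q k) = 1)
    (l : ℕ → ℕ) (hl : ∀ n, 5 ≤ l n) (n k : ℕ) (u : E2 → ℝ) :
    ∃ v : E2 → ℝ, Set.EqOn v u (Vn q l n) ∧ En q l (n + k) v v = En q l n u u := by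
  induction k with
  | zero => exact ⟨u, fun _ _ => rfl, rfl⟩
  | succ k ih =>
    obtain ⟨v, h1, h2⟩ := ih
    obtain ⟨v', h3, h4⟩ := ext_step q hq l hl (n + k) v
    exact ⟨v', fun x hx => (h3 (Vn_sub_add q l hl n k hx)).trans (h1 hx), h4.trans h2⟩

/-- Compatibility of the sequence of forms `(Eⁿ)`: the minimum of
`E^{n+k}(v,v)` over `v` with `v|_{V_n} = u` is attained and equals `Eⁿ(u,u)`. -/
theorem stmt3 (q : Fin 3 → E2) (hq : ∀ j k : Fin 3, j ≠ k → dist (q j) (q k) = 1)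
    (l : ℕ → ℕ) (hl : ∀ n, 5 ≤ l n) (n k : ℕ) (u : E2 → ℝ) :
    ∃ v : E2 → ℝ, Set.EqOn v u (Vn q l n) ∧
      En q l (n + k) v v = En q l n u u ∧
      ∀ v' : E2 → ℝ, Set.EqOn v' u (Vn q l n) →
        En q l n u u ≤ En q l (n + k) v' v' := by
  obtain ⟨v, h1, h2⟩ := ext_add q hq l hl n k u
  refine ⟨v, h1, h2, fun v' hv' => ?_⟩
  rw [← En_congr q l n u v' hv']
  exact En_mono_add q l hl n k v'
end
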